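/- arXiv:1403.1195 — 4 statements merged into one kernel-verified Lean document; each statement's English description precedes it below -/
import Mathlib

section
/- Let G be a group with a finite symmetric generating set S (e ∉ S) and let P be the lazy simple random walk measure. Suppose there are constants K, L > 0 and γ ∈ [0,1) such that P^{(n)}(e) ≥ L·exp(−K·n^γ) for all n ≥ 1, and suppose there are constants M, N > 0 with P^{(n)}(g) ≤ P^{(n)}(e)·N·exp(−M·|g|²/n) for all g ∈ G and all n ≥ 1. Then for every ε > 0 there is a constant K_ε > 0 such that E|P^{(n)}| ≤ K_ε·n^{1/(2(1−γ)) + ε} for all n ≥ 1 (so the speed exponent is at most 1/(2(1−γ))). Consequently, if γ < 1/2 then E|P^{(n)}|/n → 0 as n → ∞ (i.e. G is Liouville). -/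
open scoped Classical

noncomputable section

/-- Word length of `g` with respect to the generating set `S`
(least `n` such that `g` is a product of `n` elements of `S`). -/
def wordLength {G : Type*} [Group G] (S : Set G) (g : G) : ℕ :=
  sInf {n | ∃ l : List G, (∀ x ∈ l, x ∈ S) ∧ l.length = n ∧ l.prod = g}

/-- The ball of radius `n` with respect to the generating set `S`. -/
def ball {G : Type*} [Group G] (S : Set G) (n : ℕ) : Set G :=
  {g | wordLength S g ≤ n}

/-- The lazy simple random walk measure `P = (1/2)(δ_e + U_S)`. -/
def lazyWalk {G : Type*} [Group G] (S : Finset G) : G → ℝ := fun g =>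
  (if g = 1 then (1 : ℝ) / 2 else 0) + (if g ∈ S then 1 / (2 * (S.card : ℝ)) else 0)

/-- The `n`-fold convolution power of a measure `P` (with `P^{(0)} = δ_e`). -/
def convPow {G : Type*} [Group G] (P : G → ℝ) : ℕ → G → ℝ
  | 0 => fun g => if g = 1 then 1 else 0
  | n + 1 => fun g => ∑' h : G, convPow P n h * P (h⁻¹ * g)

/-- The speed (expected word length) of the walk at time `n`. -/
def speed {G : Type*} [Group G] (S : Set G) (P : G → ℝ) (n : ℕ) : ℝ :=
  ∑' g : G, convPow P n g * (wordLength S g : ℝ)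

/-- The entropy of a measure `Q`, with the convention `0 · ln 0 = 0`. -/
def entropy {G : Type*} [Group G] (Q : G → ℝ) : ℝ :=
  -∑' g : G, Q g * Real.log (Q g)

/-- A real Hilbert space equipped with an isometric linear `G`-representation and
a cocycle for it: `b (x y) = λ(x) b(y) + b(x)`. -/
structure HilbertCocycle (G : Type*) [Group G] where
  space : Type
  [nacg : NormedAddCommGroup space]
  [ips : InnerProductSpace ℝ space]
  [complete : CompleteSpace space]
  rep : G →* (space ≃ₗᵢ[ℝ] space)
  cocycle : G → space
  cocycle_rel : ∀ x y : G, cocycle (x * y) = rep x (cocycle y) + cocycle x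

attribute [instance] HilbertCocycle.nacg HilbertCocycle.ips HilbertCocycle.complete

/-- The set of values at `x` of concave functions on `[0,∞)` dominating `f` on `ℕ`. -/
def concaveMajorants (f : ℕ → ℝ) (x : ℝ) : Set ℝ :=
  {y | ∃ h : ℝ → ℝ, ConcaveOn ℝ (Set.Ici 0) h ∧ (∀ k : ℕ, f k ≤ h k) ∧ y = h x}

/-- The concave hull of `f : ℕ → ℝ`: the pointwise infimum of concave majorants. -/
def concaveHull (f : ℕ → ℝ) (x : ℝ) : ℝ := sInf (concaveMajorants f x)

/-- The log-volume of the ball of radius `n`. -/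
def growthLog {G : Type*} [Group G] (S : Set G) (n : ℕ) : ℝ :=
  Real.log (Nat.card ↥(ball S n))

end

section Convolution

variable {G : Type*} [Group G] {P : G → ℝ}

/-- Convolution powers of a finitely supported function are powers in the group algebra. -/
lemma convPow_eq_coeff (hP : P.support.Finite) (n : ℕ) :
    convPow P n = ((MonoidAlgebra.ofCoeff (Finsupp.ofSupportFinite P hP)) ^ n).coeff := by
  induction n with
  | zero =>
    ext g
    simp [convPow, MonoidAlgebra.one_def, Finsupp.single_apply, eq_comm]
  | succ n ih =>
    ext g
    rw [pow_succ, MonoidAlgebra.coeff_mul_apply_left]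
    simp only [convPow, ih]
    rw [tsum_eq_sum (s := ((MonoidAlgebra.ofCoeff
      (Finsupp.ofSupportFinite P hP)) ^ n).coeff.support)]
    · rfl
    · intro h hh
      rw [Finsupp.notMem_support_iff.mp hh, zero_mul]

lemma convPow_support_finite (hP : P.support.Finite) (n : ℕ) :
    (convPow P n).support.Finite := by
  rw [convPow_eq_coeff hP]
  exact Finsupp.hasFiniteSupport _

lemma summable_convPow_mul (hP : P.support.Finite) (n : ℕ) (f : G → ℝ) :
    Summable fun g => convPow P n g * f g :=
  summable_of_hasFiniteSupport <| (convPow_support_finite hP n).subset <|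
    Function.support_mul_subset_left _ _

lemma convPow_add (hP : P.support.Finite) (m n : ℕ) (g : G) :
    convPow P (m + n) g = ∑' h, convPow P m h * convPow P n (h⁻¹ * g) := by
  rw [convPow_eq_coeff hP (m + n), pow_add, MonoidAlgebra.coeff_mul_apply_left,
    convPow_eq_coeff hP m, convPow_eq_coeff hP n,
    tsum_eq_sum (s := ((MonoidAlgebra.ofCoeff
      (Finsupp.ofSupportFinite P hP)) ^ m).coeff.support)]
  · rfl
  · intro h hh
    rw [Finsupp.notMem_support_iff.mp hh, zero_mul]

lemma convPow_one (g : G) : convPow P 1 g = P g := by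
  simp only [convPow]
  rw [tsum_eq_single 1]
  · simp
  · intro h hh
    simp [hh]

lemma convPow_nonneg (hP : ∀ g, 0 ≤ P g) (n : ℕ) (g : G) : 0 ≤ convPow P n g := by
  induction n generalizing g with
  | zero => simp only [convPow]; split_ifs <;> norm_num
  | succ n ih => exact tsum_nonneg fun h => mul_nonneg (ih h) (hP _)

lemma tsum_convPow (hP : P.support.Finite) (h1 : ∑' g, P g = 1) (n : ℕ) :
    ∑' g, convPow P n g = 1 := by
  have key : ∀ x : MonoidAlgebra ℝ G,
      MonoidAlgebra.lift ℝ ℝ G 1 x = ∑' g, x.coeff g := by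
    intro x
    rw [MonoidAlgebra.lift_apply, tsum_eq_sum (s := x.coeff.support)]
    · simp [Finsupp.sum]
    · intro g hg
      exact Finsupp.notMem_support_iff.mp hg
  rw [convPow_eq_coeff hP, ← key, map_pow, key]
  change (∑' g, P g) ^ n = 1
  rw [h1, one_pow]

lemma convPow_inv (hP : P.support.Finite) (hsymm : ∀ g, P g⁻¹ = P g) (n : ℕ) (g : G) :
    convPow P n g⁻¹ = convPow P n g := by
  induction n generalizing g with
  | zero => simp [convPow]
  | succ n ih =>
    conv_rhs => rw [add_comm, convPow_add hP]
    simp only [convPow_one]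
    simp only [convPow]
    rw [← (Equiv.mulLeft g⁻¹).tsum_eq]
    refine tsum_congr fun h => ?_
    simp only [Equiv.coe_mulLeft, mul_inv_rev, inv_inv, mul_assoc, mul_inv_cancel, mul_one]
    rw [hsymm, ← ih (g⁻¹ * h), mul_comm]
    simp

/-- By Cauchy-Schwarz, an even convolution power of a symmetric function is maximal at `1`. -/
lemma convPow_even_le_one (hP : P.support.Finite) (hsymm : ∀ g, P g⁻¹ = P g) {n : ℕ}
    (hn : Even n) (g : G) : convPow P n g ≤ convPow P n 1 := by
  obtain ⟨k, rfl⟩ := hn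
  rw [convPow_add hP, convPow_add hP]
  simp only [mul_one, convPow_inv hP hsymm]
  have hs : Summable fun h => convPow P k h * convPow P k h := summable_convPow_mul hP k _
  have he : ∑' h, convPow P k (h⁻¹ * g) * convPow P k (h⁻¹ * g)
      = ∑' h, convPow P k h * convPow P k h :=
    ((Equiv.inv G).trans (Equiv.mulRight g)).tsum_eq fun h => convPow P k h * convPow P k h
  have hs' : Summable fun h => convPow P k (h⁻¹ * g) * convPow P k (h⁻¹ * g) :=
    ((Equiv.inv G).trans (Equiv.mulRight g)).summable_iff.mpr hs
  calc ∑' h, convPow P k h * convPow P k (h⁻¹ * g)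
      ≤ ∑' h, (1 / 2 * (convPow P k h * convPow P k h)
          + 1 / 2 * (convPow P k (h⁻¹ * g) * convPow P k (h⁻¹ * g))) := by
        refine (summable_convPow_mul hP k _).tsum_le_tsum (fun h => ?_)
          ((hs.mul_left _).add (hs'.mul_left _))
        nlinarith [sq_nonneg (convPow P k h - convPow P k (h⁻¹ * g))]
    _ = ∑' h, convPow P k h * convPow P k h := by
        rw [(hs.mul_left _).tsum_add (hs'.mul_left _), tsum_mul_left, tsum_mul_left, he]
        ring

end Convolution

section LazyWalk

variable {G : Type*} [Group G] {S : Finset G}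

lemma lazyWalk_nonneg (g : G) : 0 ≤ lazyWalk S g := by
  unfold lazyWalk
  positivity

lemma lazyWalk_eq_zero {g : G} (h1 : g ≠ 1) (hS : g ∉ S) : lazyWalk S g = 0 := by
  simp [lazyWalk, h1, hS]

lemma lazyWalk_support_finite : (lazyWalk S).support.Finite := by
  refine (insert 1 S).finite_toSet.subset fun g hg => ?_
  by_contra h
  simp only [Finset.coe_insert, Set.mem_insert_iff, Finset.mem_coe, not_or] at h
  exact hg (lazyWalk_eq_zero h.1 h.2)

lemma lazyWalk_inv (hsym : ∀ s ∈ S, s⁻¹ ∈ S) (g : G) : lazyWalk S g⁻¹ = lazyWalk S g := by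
  have : g⁻¹ ∈ S ↔ g ∈ S := ⟨fun h => by simpa using hsym _ h, hsym g⟩
  simp [lazyWalk, this]

lemma tsum_lazyWalk (hS : S.Nonempty) : ∑' g, lazyWalk S g = 1 := by
  have hc : (S.card : ℝ) ≠ 0 := by exact_mod_cast hS.card_ne_zero
  have h1 : HasSum (fun g : G => if g = 1 then (1 : ℝ) / 2 else 0) (1 / 2) :=
    hasSum_ite_eq 1 _
  have h2 : HasSum (fun g : G => if g ∈ S then 1 / (2 * (S.card : ℝ)) else 0) (1 / 2) := by
    have : HasSum (fun g : G => if g ∈ S then 1 / (2 * (S.card : ℝ)) else 0)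
        (∑ g ∈ S, if g ∈ S then 1 / (2 * (S.card : ℝ)) else 0) :=
      hasSum_sum_of_ne_finset_zero (by simp +contextual)
    convert this using 1
    simp only [Finset.sum_ite_mem, Finset.inter_self, Finset.sum_const, nsmul_eq_mul]
    field_simp
  have h := (h1.add h2).tsum_eq
  norm_num only at h
  simpa [lazyWalk] using h

lemma half_mul_convPow_le_succ (n : ℕ) (g : G) :
    1 / 2 * convPow (lazyWalk S) n g ≤ convPow (lazyWalk S) (n + 1) g := by
  have hs := summable_convPow_mul (lazyWalk_support_finite (S := S)) n
    (fun h => lazyWalk S (h⁻¹ * g))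
  have := hs.le_tsum g fun h _ =>
    mul_nonneg (convPow_nonneg lazyWalk_nonneg _ _) (lazyWalk_nonneg _)
  refine le_trans ?_ this
  have hhalf : 1 / 2 ≤ lazyWalk S (g⁻¹ * g) := by
    simp only [inv_mul_cancel, lazyWalk, if_true, le_add_iff_nonneg_right]
    positivity
  nlinarith [convPow_nonneg (lazyWalk_nonneg (S := S)) n g]

lemma exists_list_of_convPow_ne_zero {n : ℕ} {g : G} (h : convPow (lazyWalk S) n g ≠ 0) :
    ∃ l : List G, (∀ x ∈ l, x ∈ (S : Set G)) ∧ l.length ≤ n ∧ l.prod = g := by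
  induction n generalizing g with
  | zero =>
    have : g = 1 := by
      by_contra hg
      simp [convPow, hg] at h
    exact ⟨[], by simp, by simp, by simp [this]⟩
  | succ n ih =>
    obtain ⟨k, hk⟩ : ∃ k, convPow (lazyWalk S) n k * lazyWalk S (k⁻¹ * g) ≠ 0 := by
      by_contra! hcon
      exact h (by simp [convPow, hcon])
    obtain ⟨l, hl, hln, rfl⟩ := ih (left_ne_zero_of_mul hk)
    by_cases h1 : l.prod⁻¹ * g = 1
    · exact ⟨l, hl, by omega, (inv_mul_eq_one.mp h1)⟩
    · have hS : l.prod⁻¹ * g ∈ S := by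
        by_contra hS
        exact right_ne_zero_of_mul hk (lazyWalk_eq_zero h1 hS)
      refine ⟨l ++ [l.prod⁻¹ * g], ?_, by simpa using hln, by simp⟩
      intro x hx
      rcases List.mem_append.mp hx with hx | hx
      · exact hl x hx
      · rw [List.mem_singleton.mp hx]
        exact hS

lemma wordLength_le_of_convPow_ne_zero {n : ℕ} {g : G} (h : convPow (lazyWalk S) n g ≠ 0) :
    wordLength (S : Set G) g ≤ n := by
  obtain ⟨l, hl, hln, hg⟩ := exists_list_of_convPow_ne_zero h
  have hmin : wordLength (S : Set G) g ≤ l.length := Nat.sInf_le ⟨l, hl, rfl, hg⟩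
  exact hmin.trans hln

lemma speed_nonneg (n : ℕ) : 0 ≤ speed (S : Set G) (lazyWalk S) n :=
  tsum_nonneg fun _ => mul_nonneg (convPow_nonneg lazyWalk_nonneg _ _) (Nat.cast_nonneg _)

lemma speed_le_two_mul_succ (n : ℕ) :
    speed (S : Set G) (lazyWalk S) n ≤ 2 * speed (S : Set G) (lazyWalk S) (n + 1) := by
  unfold speed
  rw [← tsum_mul_left]
  refine (summable_convPow_mul lazyWalk_support_finite n _).tsum_le_tsum (fun g => ?_)
    ((summable_convPow_mul lazyWalk_support_finite _ _).mul_left _)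
  nlinarith [half_mul_convPow_le_succ (S := S) n g,
    (Nat.cast_nonneg (wordLength (S : Set G) g) : (0 : ℝ) ≤ _)]

/-- The probability that the lazy walk at time `n` is at distance at least `r`. -/
noncomputable def tailProb (S : Finset G) (n r : ℕ) : ℝ :=
  ∑' g, convPow (lazyWalk S) n g * if r ≤ wordLength (S : Set G) g then 1 else 0

lemma tailProb_le_one (hS : S.Nonempty) (n r : ℕ) : tailProb S n r ≤ 1 := by
  rw [← tsum_convPow lazyWalk_support_finite (tsum_lazyWalk hS) n]
  refine (summable_convPow_mul lazyWalk_support_finite n _).tsum_le_tsum (fun g => ?_)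
    (summable_of_hasFiniteSupport (convPow_support_finite lazyWalk_support_finite n))
  have := convPow_nonneg (lazyWalk_nonneg (S := S)) n g
  split_ifs <;> simp [this]

lemma speed_eq_sum_tailProb (n : ℕ) :
    speed (S : Set G) (lazyWalk S) n = ∑ k ∈ Finset.Icc 1 n, tailProb S n k := by
  unfold speed tailProb
  rw [← Summable.tsum_finsetSum fun k _ =>
    summable_convPow_mul lazyWalk_support_finite n _]
  refine tsum_congr fun g => ?_
  by_cases hg : convPow (lazyWalk S) n g = 0
  · simp [hg]
  have hle := wordLength_le_of_convPow_ne_zero hg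
  rw [← Finset.mul_sum, Finset.sum_boole]
  have : {k ∈ Finset.Icc 1 n | k ≤ wordLength (S : Set G) g}
      = Finset.Icc 1 (wordLength (S : Set G) g) := by
    ext k
    simp only [Finset.mem_filter, Finset.mem_Icc]
    omega
  rw [this]
  simp

lemma speed_le (hS : S.Nonempty) (n : ℕ) : speed (S : Set G) (lazyWalk S) n ≤ n := by
  rw [speed_eq_sum_tailProb]
  refine (Finset.sum_le_sum fun k _ => tailProb_le_one hS n k).trans ?_
  simp

/-- If the heat kernel at an even time `m` has dropped by half at distance `r`, then running the
walk for `t` more steps costs a factor `1 - tailProb S t r / 2` in the return probability. -/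
lemma convPow_add_one_le (hS : S.Nonempty) (hsym : ∀ s ∈ S, s⁻¹ ∈ S) {m t r : ℕ}
    (hm : Even m)
    (hhalf : ∀ g, r ≤ wordLength (S : Set G) g →
      convPow (lazyWalk S) m g ≤ convPow (lazyWalk S) m 1 * (1 / 2)) :
    convPow (lazyWalk S) (t + m) 1 ≤ convPow (lazyWalk S) m 1 * (1 - tailProb S t r / 2) := by
  have hf := lazyWalk_support_finite (S := S)
  have hst := summable_convPow_mul hf t
    fun g => if r ≤ wordLength (S : Set G) g then (1 : ℝ) else 0
  have hs1 : Summable (convPow (lazyWalk S) t) :=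
    summable_of_hasFiniteSupport (convPow_support_finite hf t)
  rw [convPow_add hf]
  simp only [mul_one, convPow_inv hf (lazyWalk_inv hsym)]
  rw [← tsum_convPow hf (tsum_lazyWalk hS) t, tailProb, ← tsum_div_const,
    ← hs1.tsum_sub (hst.div_const 2), ← tsum_mul_left]
  refine (summable_convPow_mul hf t _).tsum_le_tsum (fun g => ?_)
    ((hs1.sub (hst.div_const 2)).mul_left _)
  have h0 := convPow_nonneg (lazyWalk_nonneg (S := S)) t g
  split_ifs with hr
  · nlinarith [hhalf g hr]
  · nlinarith [convPow_even_le_one hf (lazyWalk_inv hsym) hm g]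

lemma convPow_mul_succ_one_le (hS : S.Nonempty) (hsym : ∀ s ∈ S, s⁻¹ ∈ S) {t r J : ℕ}
    (ht : Even t)
    (hhalf : ∀ j, 1 ≤ j → j ≤ J → ∀ g, r ≤ wordLength (S : Set G) g →
      convPow (lazyWalk S) (t * j) g ≤ convPow (lazyWalk S) (t * j) 1 * (1 / 2)) :
    convPow (lazyWalk S) (t * (J + 1)) 1 ≤ Real.exp (-(J * (tailProb S t r / 2))) := by
  have hf := lazyWalk_support_finite (S := S)
  induction J with
  | zero =>
    have hs : Summable (convPow (lazyWalk S) t) :=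
      summable_of_hasFiniteSupport (convPow_support_finite hf t)
    have := hs.le_tsum 1
      fun g _ => convPow_nonneg lazyWalk_nonneg t g
    rw [tsum_convPow hf (tsum_lazyWalk hS)] at this
    simpa using this
  | succ J ih =>
    have hstep := convPow_add_one_le hS hsym (t := t) (ht.mul_right (J + 1))
      (hhalf (J + 1) (by omega) le_rfl)
    have ih' := ih fun j h1 h2 => hhalf j h1 (by omega)
    have hexp : 1 - tailProb S t r / 2 ≤ Real.exp (-(tailProb S t r / 2)) := by
      linarith [Real.add_one_le_exp (-(tailProb S t r / 2))]
    calc convPow (lazyWalk S) (t * (J + 1 + 1)) 1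
        = convPow (lazyWalk S) (t + t * (J + 1)) 1 := by congr 1; ring
      _ ≤ convPow (lazyWalk S) (t * (J + 1)) 1 * (1 - tailProb S t r / 2) := hstep
      _ ≤ convPow (lazyWalk S) (t * (J + 1)) 1 * Real.exp (-(tailProb S t r / 2)) :=
        mul_le_mul_of_nonneg_left hexp (convPow_nonneg lazyWalk_nonneg _ _)
      _ ≤ Real.exp (-(J * (tailProb S t r / 2))) * Real.exp (-(tailProb S t r / 2)) :=
        mul_le_mul_of_nonneg_right ih' (Real.exp_nonneg _)
      _ = Real.exp (-((J + 1 : ℕ) * (tailProb S t r / 2))) := by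
        rw [← Real.exp_add]
        push_cast
        ring_nf

/-- A stretched-exponential lower bound on the return probability and Gaussian off-diagonal decay
give polynomial tails for the word length of the walk. -/
lemma exists_tailProb_le (hS : S.Nonempty) (hsym : ∀ s ∈ S, s⁻¹ ∈ S)
    {K L γ : ℝ} (hK : 0 < K) (hL : 0 < L) (hγ0 : 0 ≤ γ)
    (hret : ∀ n : ℕ, 1 ≤ n →
      L * Real.exp (-K * (n : ℝ) ^ γ) ≤ convPow (lazyWalk S) n 1)
    {M N : ℝ} (hM : 0 < M) (hN : 0 < N)
    (hOD : ∀ (g : G) (n : ℕ), 1 ≤ n →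
      convPow (lazyWalk S) n g ≤
        convPow (lazyWalk S) n 1 * N *
          Real.exp (-M * (wordLength (S : Set G) g : ℝ) ^ 2 / (n : ℝ))) :
    ∃ C : ℝ, 0 < C ∧ ∀ t r : ℕ, 1 ≤ t → Even t → 1 ≤ r →
      tailProb S t r ≤ C * t * (r : ℝ) ^ (-(2 - 2 * γ)) := by
  set c : ℝ := M / (1 + |Real.log (2 * N)|) with hc
  have hc0 : 0 < c := by positivity
  have hdecay : ∀ (m r : ℕ), 1 ≤ m → (m : ℝ) ≤ c * (r : ℝ) ^ 2 → ∀ g,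
      r ≤ wordLength (S : Set G) g →
      convPow (lazyWalk S) m g ≤ convPow (lazyWalk S) m 1 * (1 / 2) := by
    intro m r hm hmr g hg
    have hm0 : (0 : ℝ) < m := by exact_mod_cast hm
    have hg' : (r : ℝ) ^ 2 ≤ (wordLength (S : Set G) g : ℝ) ^ 2 := by gcongr
    have hlog : Real.log (2 * N) ≤ M * (wordLength (S : Set G) g : ℝ) ^ 2 / m := by
      rw [le_div_iff₀ hm0]
      have h1 : (m : ℝ) * (1 + |Real.log (2 * N)|) ≤ M * (r : ℝ) ^ 2 := by
        rw [hc, div_mul_eq_mul_div, le_div_iff₀ (by positivity)] at hmr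
        exact hmr
      nlinarith [le_abs_self (Real.log (2 * N))]
    have hexp : N * Real.exp (-M * (wordLength (S : Set G) g : ℝ) ^ 2 / m) ≤ 1 / 2 := by
      have h2 : Real.exp (-M * (wordLength (S : Set G) g : ℝ) ^ 2 / m) ≤ (2 * N)⁻¹ := by
        rw [← Real.exp_log (inv_pos.mpr (by positivity : 0 < 2 * N)), Real.log_inv]
        apply Real.exp_le_exp.mpr
        rw [neg_mul, neg_div]
        linarith
      calc _ ≤ N * (2 * N)⁻¹ := by gcongr
        _ = 1 / 2 := by field_simp
    refine (hOD g m hm).trans ?_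
    rw [mul_assoc]
    exact mul_le_mul_of_nonneg_left hexp (convPow_nonneg lazyWalk_nonneg _ _)
  set D : ℝ := K * (2 * c) ^ γ + |Real.log L| with hD
  have hD0 : 0 ≤ D := by positivity
  refine ⟨4 / c * D + 1 / c, by positivity, fun t r ht hte hr => ?_⟩
  have ht0 : (0 : ℝ) < t := by exact_mod_cast ht
  have hr1 : (1 : ℝ) ≤ r := by exact_mod_cast hr
  have hr0 : (0 : ℝ) < r := by linarith
  have hpow : (r : ℝ) ^ (-(2 - 2 * γ)) = ((r : ℝ) ^ 2) ^ γ / (r : ℝ) ^ 2 := by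
    rw [neg_sub, Real.rpow_sub hr0, Real.rpow_mul hr0.le, Real.rpow_two]
  have hrγ : 1 ≤ ((r : ℝ) ^ 2) ^ γ := Real.one_le_rpow (one_le_pow₀ hr1) hγ0
  have hr2 : (0 : ℝ) < (r : ℝ) ^ 2 := by positivity
  rw [hpow]
  set R : ℝ := (r : ℝ) ^ 2 with hR
  by_cases hcase : c * R < t
  · calc tailProb S t r ≤ 1 := tailProb_le_one hS t r
      _ ≤ 1 / c * t * (1 / R) := by
        rw [one_div_mul_eq_div, div_mul_div_comm, mul_one, one_le_div (by positivity)]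
        exact hcase.le
      _ ≤ (4 / c * D + 1 / c) * t * (R ^ γ / R) := by
        gcongr
        linarith [show 0 ≤ 4 / c * D by positivity]
  push Not at hcase
  set J : ℕ := ⌊c * R / t⌋₊ with hJ
  have hJle : (J : ℝ) ≤ c * R / t := Nat.floor_le (by positivity)
  have hJt : t * (J : ℝ) ≤ c * R := by
    rw [le_div_iff₀ ht0] at hJle
    linarith
  have hJlt : c * R < t * (J + 1) := by
    have := Nat.lt_floor_add_one (c * R / t)
    rw [div_lt_iff₀ ht0] at this
    linarith
  have hJ1 : 1 ≤ J := Nat.le_floor (by rw [le_div_iff₀ ht0]; simpa using hcase)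
  have hJ1' : (1 : ℝ) ≤ J := by exact_mod_cast hJ1
  have hup := convPow_mul_succ_one_le hS hsym (r := r) (J := J) hte fun j h1 h2 =>
    hdecay (t * j) r (Nat.mul_pos ht h1) <| by
      push_cast
      refine le_trans ?_ hJt
      gcongr
  have hlow := (hret (t * (J + 1)) (Nat.mul_pos ht (Nat.succ_pos J))).trans hup
  rw [← Real.exp_log hL, ← Real.exp_add, Real.exp_le_exp] at hlow
  push_cast at hlow
  have hγle : ((t : ℝ) * (J + 1)) ^ γ ≤ (2 * c) ^ γ * R ^ γ := by
    rw [← Real.mul_rpow (by positivity) hr2.le]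
    refine Real.rpow_le_rpow (by positivity) ?_ hγ0
    nlinarith
  have hbound : J * (tailProb S t r / 2) ≤ D * R ^ γ := by
    have h1 : -Real.log L ≤ |Real.log L| * R ^ γ := by
      nlinarith [neg_abs_le (Real.log L), abs_nonneg (Real.log L)]
    have h2 := mul_le_mul_of_nonneg_left hγle hK.le
    rw [hD]
    linarith
  have hq : c * R * tailProb S t r ≤ 4 * t * (D * R ^ γ) := by
    by_cases h0 : 0 ≤ tailProb S t r
    · have : c * R ≤ 2 * t * J := by nlinarith
      calc c * R * tailProb S t r ≤ 2 * t * J * tailProb S t r := by gcongr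
        _ = 4 * t * (J * (tailProb S t r / 2)) := by ring
        _ ≤ _ := by gcongr
    · have : 0 ≤ 4 * t * (D * R ^ γ) := by positivity
      have : 0 < c * R := by positivity
      nlinarith
  calc tailProb S t r ≤ 4 * t * (D * R ^ γ) / (c * R) := by
        rw [le_div_iff₀ (by positivity)]
        linarith
    _ = 4 / c * D * t * (R ^ γ / R) := by field_simp
    _ ≤ (4 / c * D + 1 / c) * t * (R ^ γ / R) := by
        gcongr
        linarith [show 0 < 1 / c by positivity]

/-- Integrating the polynomial tail bound `C * t * r ^ (-a)` with `1 ≤ a`. -/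
lemma speed_le_of_tailProb_le (hS : S.Nonempty) {C a : ℝ} (hC : 0 < C) (ha : 1 ≤ a) {t : ℕ}
    (ht : 1 ≤ t)
    (htail : ∀ r : ℕ, 1 ≤ r → tailProb S t r ≤ C * t * (r : ℝ) ^ (-a)) {ε : ℝ} (hε : 0 < ε) :
    speed (S : Set G) (lazyWalk S) t
      ≤ (C + 1) * (1 + 1 / ε) * (t : ℝ) ^ (1 / a + ε) := by
  have ht1 : (1 : ℝ) ≤ t := by exact_mod_cast ht
  have ht0 : (0 : ℝ) < t := by linarith
  have ha0 : 0 < a := by linarith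
  set R : ℝ := (t : ℝ) ^ (1 / a) with hR
  have hR0 : 0 < R := Real.rpow_pos_of_pos ht0 _
  have hRa : R ^ a = t := by
    rw [hR, ← Real.rpow_mul ht0.le, one_div_mul_cancel ha0.ne', Real.rpow_one]
  have hterm : ∀ k ∈ Finset.Icc 1 t, tailProb S t k ≤ (C + 1) * R * (k : ℝ)⁻¹ := by
    intro k hk
    have hk1 : 1 ≤ k := (Finset.mem_Icc.mp hk).1
    have hk0 : (0 : ℝ) < k := by exact_mod_cast hk1
    by_cases hkR : (k : ℝ) ≤ R
    · refine (tailProb_le_one hS t k).trans ?_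
      rw [← div_eq_mul_inv, one_le_div hk0]
      nlinarith
    · push Not at hkR
      refine (htail k hk1).trans ?_
      have h1 : R ^ (a - 1) ≤ (k : ℝ) ^ (a - 1) :=
        Real.rpow_le_rpow hR0.le hkR.le (by linarith)
      have h2 : (t : ℝ) * (k : ℝ) ^ (-a) ≤ R * (k : ℝ)⁻¹ := by
        rw [← hRa, Real.rpow_neg hk0.le, ← div_eq_mul_inv, ← div_eq_mul_inv,
          div_le_div_iff₀ (by positivity) hk0]
        rw [Real.rpow_sub_one hR0.ne', Real.rpow_sub_one hk0.ne',
          div_le_div_iff₀ hR0 hk0] at h1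
        linarith
      have h3 : 0 ≤ R * (k : ℝ)⁻¹ := by positivity
      nlinarith
  have hharm : ∑ k ∈ Finset.Icc 1 t, (k : ℝ)⁻¹ ≤ 1 + Real.log t := by
    have := harmonic_le_one_add_log t
    rw [harmonic_eq_sum_Icc] at this
    push_cast at this
    exact this
  have hlog : 1 + Real.log t ≤ (1 + 1 / ε) * (t : ℝ) ^ ε := by
    have h1 := Real.log_le_rpow_div ht0.le hε
    have h2 := Real.one_le_rpow ht1 hε.le
    rw [div_eq_mul_one_div] at h1
    linarith
  rw [speed_eq_sum_tailProb]
  calc ∑ k ∈ Finset.Icc 1 t, tailProb S t k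
      ≤ ∑ k ∈ Finset.Icc 1 t, (C + 1) * R * (k : ℝ)⁻¹ := Finset.sum_le_sum hterm
    _ = (C + 1) * R * ∑ k ∈ Finset.Icc 1 t, (k : ℝ)⁻¹ := by rw [Finset.mul_sum]
    _ ≤ (C + 1) * R * ((1 + 1 / ε) * (t : ℝ) ^ ε) := by
        gcongr
        exact hharm.trans hlog
    _ = _ := by rw [Real.rpow_add ht0]; ring

end LazyWalk

/-- under (OD) and the return probability lower bound, the speed exponent
is at most `1/(2(1−γ))`; if moreover `γ < 1/2` the group is Liouville. -/
theorem stmt2 {G : Type*} [Group G] (S : Finset G)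
    (hS1 : (1 : G) ∉ S) (hSne : S.Nonempty) (hsym : ∀ s ∈ S, s⁻¹ ∈ S)
    (hgen : Subgroup.closure (S : Set G) = ⊤)
    (K L γ : ℝ) (hK : 0 < K) (hL : 0 < L) (hγ0 : 0 ≤ γ) (hγ1 : γ < 1)
    (hret : ∀ n : ℕ, 1 ≤ n →
      L * Real.exp (-K * (n : ℝ) ^ γ) ≤ convPow (lazyWalk S) n 1)
    (M N : ℝ) (hM : 0 < M) (hN : 0 < N)
    (hOD : ∀ (g : G) (n : ℕ), 1 ≤ n →
      convPow (lazyWalk S) n g ≤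
        convPow (lazyWalk S) n 1 * N *
          Real.exp (-M * (wordLength (S : Set G) g : ℝ) ^ 2 / (n : ℝ))) :
    (∀ ε : ℝ, 0 < ε → ∃ Kε : ℝ, 0 < Kε ∧ ∀ n : ℕ, 1 ≤ n →
        speed (S : Set G) (lazyWalk S) n ≤ Kε * (n : ℝ) ^ (1 / (2 * (1 - γ)) + ε)) ∧
      (γ < 1 / 2 →
        Filter.Tendsto (fun n : ℕ => speed (S : Set G) (lazyWalk S) n / (n : ℝ))
          Filter.atTop (nhds 0)) := by
  have hspeed : ∀ ε : ℝ, 0 < ε → ∃ Kε : ℝ, 0 < Kε ∧ ∀ n : ℕ, 1 ≤ n →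
      speed (S : Set G) (lazyWalk S) n ≤ Kε * (n : ℝ) ^ (1 / (2 * (1 - γ)) + ε) := by
    intro ε hε
    have hγ' : 0 < 1 - γ := by linarith
    by_cases hγ : γ < 1 / 2
    · obtain ⟨C, hC, htail⟩ := exists_tailProb_le hSne hsym hK hL hγ0 hret hM hN hOD
      set β : ℝ := 1 / (2 * (1 - γ)) + ε with hβ
      have hβ0 : 0 < β := by positivity
      have heven : ∀ t : ℕ, 1 ≤ t → Even t →
          speed (S : Set G) (lazyWalk S) t ≤ (C + 1) * (1 + 1 / ε) * (t : ℝ) ^ β := by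
        intro t ht hte
        have := speed_le_of_tailProb_le hSne hC (a := 2 - 2 * γ) (by linarith) ht
          (fun r hr => htail t r ht hte hr) hε
        rwa [show 2 - 2 * γ = 2 * (1 - γ) by ring] at this
      set B : ℝ := (C + 1) * (1 + 1 / ε) with hB
      have hB0 : 0 < B := by positivity
      refine ⟨2 * B * 2 ^ β, by positivity, fun n hn => ?_⟩
      have hn1 : (1 : ℝ) ≤ n := by exact_mod_cast hn
      have h2 : (1 : ℝ) ≤ 2 ^ β := Real.one_le_rpow (by norm_num) hβ0.le
      rcases Nat.even_or_odd n with he | ho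
      · refine (heven n hn he).trans ?_
        gcongr
        nlinarith
      · have h1 := heven (n + 1) (by omega) ho.add_one
        calc speed (S : Set G) (lazyWalk S) n
            ≤ 2 * speed (S : Set G) (lazyWalk S) (n + 1) := speed_le_two_mul_succ n
          _ ≤ 2 * (B * ((n + 1 : ℕ) : ℝ) ^ β) := by gcongr
          _ ≤ 2 * (B * (2 * (n : ℝ)) ^ β) := by
            gcongr
            push_cast
            linarith
          _ = 2 * B * 2 ^ β * (n : ℝ) ^ β := by
            rw [Real.mul_rpow (by norm_num) (by positivity)]
            ring
    · refine ⟨1, one_pos, fun n hn => (speed_le hSne n).trans ?_⟩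
      have hn1 : (1 : ℝ) ≤ n := by exact_mod_cast hn
      have h1 : 1 ≤ 1 / (2 * (1 - γ)) := by
        rw [one_le_div (by positivity)]
        linarith
      rw [one_mul]
      exact Real.self_le_rpow_of_one_le hn1 (by linarith)
  refine ⟨hspeed, fun hγ => ?_⟩
  have hβ : 1 / (2 * (1 - γ)) < 1 := by
    rw [div_lt_one (by linarith)]
    linarith
  set δ : ℝ := (1 - 1 / (2 * (1 - γ))) / 2 with hδ
  have hδ0 : 0 < δ := by linarith
  obtain ⟨B, -, hBle⟩ := hspeed δ hδ0
  have hlim : Filter.Tendsto (fun n : ℕ => B * (n : ℝ) ^ (-δ)) Filter.atTop (nhds 0) := by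
    simpa using ((tendsto_rpow_neg_atTop hδ0).comp tendsto_natCast_atTop_atTop).const_mul B
  refine squeeze_zero' (Filter.Eventually.of_forall fun n =>
    div_nonneg (speed_nonneg n) (Nat.cast_nonneg n)) ?_ hlim
  filter_upwards [Filter.eventually_ge_atTop 1] with n hn
  have hn0 : (0 : ℝ) < n := by exact_mod_cast hn
  rw [div_le_iff₀ hn0, mul_assoc, ← Real.rpow_add_one hn0.ne']
  rw [show -δ + 1 = 1 / (2 * (1 - γ)) + δ by linarith]
  exact hBle n hn
end

section
/- Let G be a group with a finite symmetric generating set S (e ∉ S) and let P be the lazy simple random walk measure. Suppose there are constants K, L > 0 and ν ∈ (0,1] such that |B_n| ≤ L·exp(K·n^ν) for all n ≥ 1, and suppose there are constants K', L' > 0 and h ∈ (0,1] such that H(P^{(n)}) ≥ K' + L'·n^h for all n ≥ 1. Then for every real Hilbert space ℋ, every homomorphism λ from G to the group of linear isometries of ℋ, every λ-cocycle b : G → ℋ, and all constants c ≥ 0 and K'' > 0 such that ‖b(g)‖ ≥ K''·|g|^c for all g ∈ G, one has 2·h·c ≤ ν (i.e. the equivariant Hilbertian compression exponent satisfies 2hα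 ≤ ν). -/
open scoped Classical

section WordMetric

variable {G : Type*} [Group G] {S : Finset G}

theorem exists_list_length_eq_wordLength (hsym : ∀ s ∈ S, s⁻¹ ∈ S)
    (hgen : Subgroup.closure (S : Set G) = ⊤) (g : G) :
    ∃ l : List G, (∀ x ∈ l, x ∈ (S : Set G)) ∧ l.length = wordLength (S : Set G) g ∧
      l.prod = g := by
  have hne : {n | ∃ l : List G, (∀ x ∈ l, x ∈ (S : Set G)) ∧ l.length = n ∧
      l.prod = g}.Nonempty := by
    have hg : g ∈ (Subgroup.closure (S : Set G)).toSubmonoid := by rw [hgen]; trivial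
    rw [Subgroup.closure_toSubmonoid] at hg
    obtain ⟨l, hl, hprod⟩ := Submonoid.exists_list_of_mem_closure hg
    refine ⟨l.length, l, fun x hx => ?_, rfl, hprod⟩
    rcases hl x hx with h | h
    · exact h
    · simpa using hsym _ h
  exact Nat.sInf_mem hne

theorem ball_finite (hsym : ∀ s ∈ S, s⁻¹ ∈ S)
    (hgen : Subgroup.closure (S : Set G) = ⊤) (n : ℕ) : (ball (S : Set G) n).Finite := by
  refine ((List.finite_length_le S n).image fun l => (l.map Subtype.val).prod).subset ?_
  intro g hg
  obtain ⟨l, hl, hlen, hprod⟩ := exists_list_length_eq_wordLength hsym hgen g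
  lift l to List S using hl
  refine ⟨l, ?_, hprod⟩
  rw [List.length_map] at hlen
  exact hlen.le.trans hg

theorem summable_exp_neg_mul_rpow {K ν : ℝ} (hK : 0 < K) (hν : 0 < ν) :
    Summable fun n : ℕ => Real.exp (-K * (n : ℝ) ^ ν) := by
  have h1 := (isLittleO_exp_neg_mul_rpow_atTop hK (-2 / ν)).comp_tendsto
    ((tendsto_rpow_atTop hν).comp tendsto_natCast_atTop_atTop)
  refine summable_of_isBigO_nat (g := fun n : ℕ => (n : ℝ) ^ (-2 : ℝ)) ?_ ?_
  · exact Real.summable_nat_rpow.2 (by norm_num)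
  · refine h1.isBigO.congr_right fun n => ?_
    simp only [Function.comp_apply]
    rw [← Real.rpow_mul n.cast_nonneg]
    congr 1
    field_simp

/-- Subexponential volume growth makes the weights `exp (-2K|g|^ν)` uniformly summable. -/
theorem exists_sum_exp_neg_wordLength_le (hsym : ∀ s ∈ S, s⁻¹ ∈ S)
    (hgen : Subgroup.closure (S : Set G) = ⊤) {K L ν : ℝ} (hK : 0 < K) (hL : 0 < L)
    (hν0 : 0 < ν)
    (hvol : ∀ n : ℕ, 1 ≤ n →
      (Nat.card ↥(ball (S : Set G) n) : ℝ) ≤ L * Real.exp (K * (n : ℝ) ^ ν)) :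
    ∃ Z : ℝ, 0 ≤ Z ∧ ∀ F : Finset G,
      ∑ g ∈ F, Real.exp (-(2 * K * (wordLength (S : Set G) g : ℝ) ^ ν)) ≤ Z := by
  have hball : ∀ n : ℕ, (Nat.card ↥(ball (S : Set G) n) : ℝ) ≤
      L * Real.exp K * Real.exp (K * (n : ℝ) ^ ν) := by
    intro n
    rcases Nat.eq_zero_or_pos n with rfl | hn
    · have hmono : Nat.card ↥(ball (S : Set G) 0) ≤ Nat.card ↥(ball (S : Set G) 1) :=
        Nat.card_mono (ball_finite hsym hgen 1) fun g (hg : _ ≤ 0) =>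
          show _ ≤ 1 from hg.trans zero_le_one
      have h1 := hvol 1 le_rfl
      have h2 : (Nat.card ↥(ball (S : Set G) 0) : ℝ) ≤ Nat.card ↥(ball (S : Set G) 1) := by
        exact_mod_cast hmono
      simp only [Nat.cast_one, Real.one_rpow, mul_one] at h1
      simpa [Real.zero_rpow hν0.ne'] using h2.trans h1
    · refine (hvol n hn).trans ?_
      have : 1 ≤ Real.exp K := Real.one_le_exp hK.le
      gcongr
      nlinarith
  have hsum := summable_exp_neg_mul_rpow hK hν0
  refine ⟨L * Real.exp K * ∑' n : ℕ, Real.exp (-K * (n : ℝ) ^ ν), by positivity, fun F => ?_⟩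
  have hmaps : ∀ g ∈ F, wordLength (S : Set G) g ∈ F.image (wordLength (S : Set G)) :=
    fun g hg => Finset.mem_image_of_mem _ hg
  rw [← Finset.sum_fiberwise_of_maps_to hmaps]
  calc _ ≤ ∑ n ∈ F.image (wordLength (S : Set G)),
        L * Real.exp K * Real.exp (-K * (n : ℝ) ^ ν) := by
        refine Finset.sum_le_sum fun n _ => ?_
        have hfib : ∑ g ∈ F with wordLength (S : Set G) g = n,
            Real.exp (-(2 * K * (wordLength (S : Set G) g : ℝ) ^ ν)) =
            (F.filter fun g => wordLength (S : Set G) g = n).card *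
              Real.exp (-(2 * K * (n : ℝ) ^ ν)) := by
          rw [← nsmul_eq_mul]
          refine Finset.sum_eq_card_nsmul fun g hg => ?_
          rw [(Finset.mem_filter.1 hg).2]
        have hcard : ((F.filter fun g => wordLength (S : Set G) g = n).card : ℝ) ≤
            Nat.card ↥(ball (S : Set G) n) := by
          rw [← Set.ncard_coe_finset, ← Nat.card_coe_set_eq]
          have hsub : ((F.filter fun g => wordLength (S : Set G) g = n : Finset G) : Set G) ⊆
              ball (S : Set G) n := fun g hg => (Finset.mem_filter.1 hg).2.le
          exact_mod_cast Nat.card_mono (ball_finite hsym hgen n) hsub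
        rw [hfib]
        calc _ ≤ L * Real.exp K * Real.exp (K * (n : ℝ) ^ ν) *
              Real.exp (-(2 * K * (n : ℝ) ^ ν)) := by
              gcongr
              exact hcard.trans (hball n)
          _ = _ := by
              rw [mul_assoc, ← Real.exp_add]
              congr 2
              ring
    _ ≤ _ := by
        rw [← Finset.mul_sum]
        gcongr
        exact hsum.sum_le_tsum _ fun _ _ => (Real.exp_pos _).le

end WordMetric

section Expectation

variable {G : Type*} {E : Type*} [AddCommGroup E] [Module ℝ E]

/-- The integral of `φ` against a finitely supported (signed) measure, viewed as an element of
the group algebra. -/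
noncomputable def expect (q : MonoidAlgebra ℝ G) (φ : G → E) : E :=
  Finsupp.linearCombination ℝ φ q.coeff

theorem expect_eq_sum (q : MonoidAlgebra ℝ G) (φ : G → E) :
    expect q φ = ∑ g ∈ q.coeff.support, q.coeff g • φ g :=
  Finsupp.linearCombination_apply ℝ q.coeff

theorem expect_add_left (p q : MonoidAlgebra ℝ G) (φ : G → E) :
    expect (p + q) φ = expect p φ + expect q φ := by
  simp [expect]

theorem expect_smul_left (r : ℝ) (q : MonoidAlgebra ℝ G) (φ : G → E) :
    expect (r • q) φ = r • expect q φ := by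
  simp [expect]

theorem expect_sum_left {ι : Type*} (s : Finset ι) (q : ι → MonoidAlgebra ℝ G) (φ : G → E) :
    expect (∑ i ∈ s, q i) φ = ∑ i ∈ s, expect (q i) φ := by
  simp [expect]

@[simp]
theorem expect_single (g : G) (r : ℝ) (φ : G → E) :
    expect (MonoidAlgebra.single g r) φ = r • φ g := by
  simp [expect]

theorem expect_mul [Group G] (p q : MonoidAlgebra ℝ G) (φ : G → E) :
    expect (p * q) φ = expect p fun x => expect q fun y => φ (x * y) := by
  induction p using MonoidAlgebra.induction_linear with
  | zero => simp [expect]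
  | add p p' hp hp' => rw [add_mul, expect_add_left, expect_add_left, hp, hp']
  | single g r =>
    induction q using MonoidAlgebra.induction_linear with
    | zero => simp [expect]
    | add q q' hq hq' =>
      rw [mul_add, expect_add_left, hq, hq']
      simp [expect_add_left]
    | single g' r' => simp [MonoidAlgebra.single_mul_single, mul_smul]

theorem expect_comm (p q : MonoidAlgebra ℝ G) (φ : G → G → E) :
    (expect p fun x => expect q fun y => φ x y) = expect q fun y => expect p fun x => φ x y := by
  simp only [expect_eq_sum, Finset.smul_sum]
  rw [Finset.sum_comm]
  exact Finset.sum_congr rfl fun _ _ => Finset.sum_congr rfl fun _ _ => smul_comm _ _ _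

end Expectation

section LazyWalk

variable {G : Type*} [Group G] {S : Finset G}

/-- The lazy walk measure as an element of the group algebra. -/
noncomputable def lazyElement (S : Finset G) : MonoidAlgebra ℝ G :=
  MonoidAlgebra.single 1 (1 / 2) + ∑ s ∈ S, MonoidAlgebra.single s (1 / (2 * (S.card : ℝ)))

theorem coeff_lazyElement (S : Finset G) (g : G) : (lazyElement S).coeff g = lazyWalk S g := by
  simp only [lazyElement, lazyWalk, MonoidAlgebra.coeff_add, MonoidAlgebra.coeff_sum,
    Finsupp.add_apply, Finsupp.finsetSum_apply, MonoidAlgebra.coeff_single,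
    Finsupp.single_apply, Finset.sum_ite_eq', eq_comm (a := (1 : G))]

theorem coeff_lazyElement_pow (S : Finset G) (n : ℕ) (g : G) :
    (lazyElement S ^ n).coeff g = convPow (lazyWalk S) n g := by
  induction n generalizing g with
  | zero => simp [convPow, MonoidAlgebra.one_def, Finsupp.single_apply, eq_comm]
  | succ n ih =>
    rw [pow_succ, MonoidAlgebra.coeff_mul_apply_left, Finsupp.sum]
    simp only [convPow]
    rw [tsum_eq_sum (s := (lazyElement S ^ n).coeff.support)]
    · simp only [ih, coeff_lazyElement]
    · intro x hx
      rw [← ih, Finsupp.notMem_support_iff.1 hx, zero_mul]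

theorem coeff_lazyElement_pow_nonneg (S : Finset G) (n : ℕ) (g : G) :
    0 ≤ (lazyElement S ^ n).coeff g := by
  rw [coeff_lazyElement_pow]
  induction n generalizing g with
  | zero => simp only [convPow]; split_ifs <;> norm_num
  | succ n ih =>
    refine tsum_nonneg fun x => mul_nonneg (ih x) ?_
    simp only [lazyWalk]
    positivity

theorem expect_lazyElement_pow_one (hS : S.Nonempty) (n : ℕ) :
    expect (lazyElement S ^ n) (fun _ => (1 : ℝ)) = 1 := by
  induction n with
  | zero => simp [MonoidAlgebra.one_def]
  | succ n ih =>
    have hcard : (S.card : ℝ) ≠ 0 := by exact_mod_cast hS.card_ne_zero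
    have h1 : expect (lazyElement S) (fun _ => (1 : ℝ)) = 1 := by
      simp only [lazyElement, expect_add_left, expect_sum_left, expect_single, smul_eq_mul,
        Finset.sum_const, nsmul_eq_mul]
      field_simp
      norm_num
    rw [pow_succ, expect_mul]
    simp only [h1, ih]

variable {E : Type*} [AddCommGroup E] [Module ℝ E]

theorem expect_lazyElement_inv (hsym : ∀ s ∈ S, s⁻¹ ∈ S) (φ : G → E) :
    expect (lazyElement S) (fun g => φ g⁻¹) = expect (lazyElement S) φ := by
  simp only [lazyElement, expect_add_left, expect_sum_left, expect_single, inv_one]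
  congr 1
  exact Finset.sum_bij' (fun s _ => s⁻¹) (fun s _ => s⁻¹) hsym hsym
    (fun _ _ => inv_inv _) (fun _ _ => inv_inv _) (fun _ _ => rfl)

theorem expect_lazyElement_pow_inv (hsym : ∀ s ∈ S, s⁻¹ ∈ S) (n : ℕ) (φ : G → E) :
    expect (lazyElement S ^ n) (fun g => φ g⁻¹) = expect (lazyElement S ^ n) φ := by
  induction n generalizing φ with
  | zero => simp [MonoidAlgebra.one_def]
  | succ n ih =>
    calc _ = expect (lazyElement S ^ n) fun x => expect (lazyElement S) fun y =>
          φ (y⁻¹ * x⁻¹) := by rw [pow_succ, expect_mul]; simp only [mul_inv_rev]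
      _ = expect (lazyElement S ^ n) fun x => expect (lazyElement S) fun y => φ (y * x) := by
          rw [← ih]
          simp only [inv_inv, ← expect_lazyElement_inv hsym (fun y => φ (y * _))]
      _ = _ := by rw [expect_comm, pow_succ', expect_mul]

end LazyWalk

section Cocycle

variable {G : Type*} {S : Finset G} {H : Type*} [NormedAddCommGroup H]
  [InnerProductSpace ℝ H]

theorem norm_cocycle_mul [Group G] {lam : G →* (H ≃ₗᵢ[ℝ] H)} {b : G → H}
    (hb : ∀ x y : G, b (x * y) = lam x (b y) + b x) (x y : G) :
    ‖b (x * y)‖ = ‖b y - b x⁻¹‖ := by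
  have h1 : b 1 = 0 := by simpa using hb 1 1
  have hx : lam x (b x⁻¹) = -b x := by
    have := hb x x⁻¹
    rw [mul_inv_cancel, h1] at this
    exact eq_neg_of_add_eq_zero_left this.symm
  rw [← (lam x).norm_map (b y - b x⁻¹), map_sub, hx, sub_neg_eq_add, hb]

/-- The average squared distance between two independent samples is at most twice the second
moment. -/
theorem expect_expect_norm_sub_sq_le (q : MonoidAlgebra ℝ G)
    (hq : expect q (fun _ => (1 : ℝ)) = 1) (b : G → H) :
    (expect q fun x => expect q fun y => ‖b y - b x‖ ^ 2) ≤
      2 * expect q fun x => ‖b x‖ ^ 2 := by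
  have hq' : ∑ g ∈ q.coeff.support, q.coeff g = 1 := by simpa [expect_eq_sum] using hq
  have hinner : ∑ x ∈ q.coeff.support, ∑ y ∈ q.coeff.support,
      q.coeff x * (q.coeff y * inner ℝ (b y) (b x)) = ‖expect q b‖ ^ 2 := by
    rw [← real_inner_self_eq_norm_sq, expect_eq_sum, inner_sum]
    refine Finset.sum_congr rfl fun x _ => ?_
    rw [sum_inner]
    refine Finset.sum_congr rfl fun y _ => ?_
    rw [real_inner_smul_left, real_inner_smul_right]
    ring
  have key : (expect q fun x => expect q fun y => ‖b y - b x‖ ^ 2) =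
      2 * (expect q fun x => ‖b x‖ ^ 2) - 2 * ‖expect q b‖ ^ 2 := by
    rw [← hinner]
    simp only [expect_eq_sum, smul_eq_mul, norm_sub_sq_real, mul_add, mul_sub,
      Finset.sum_add_distrib, Finset.sum_sub_distrib, Finset.mul_sum]
    have e1 : ∑ x ∈ q.coeff.support, ∑ y ∈ q.coeff.support,
        q.coeff x * (q.coeff y * ‖b y‖ ^ 2) = ∑ y ∈ q.coeff.support, q.coeff y * ‖b y‖ ^ 2 := by
      simp only [← Finset.mul_sum]
      rw [← Finset.sum_mul, hq', one_mul]
    have e2 : ∑ x ∈ q.coeff.support, ∑ y ∈ q.coeff.support,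
        q.coeff x * (q.coeff y * ‖b x‖ ^ 2) = ∑ y ∈ q.coeff.support, q.coeff y * ‖b y‖ ^ 2 := by
      refine Finset.sum_congr rfl fun x _ => ?_
      rw [← Finset.mul_sum, ← Finset.sum_mul, hq', one_mul]
    rw [e1, e2]
    simp only [← Finset.mul_sum, mul_left_comm _ (2 : ℝ)]
    ring
  rw [key]
  nlinarith [sq_nonneg ‖expect q b‖]

theorem expect_norm_cocycle_sq_le [Group G] (hS : S.Nonempty) (hsym : ∀ s ∈ S, s⁻¹ ∈ S)
    {lam : G →* (H ≃ₗᵢ[ℝ] H)} {b : G → H}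
    (hb : ∀ x y : G, b (x * y) = lam x (b y) + b x) (k : ℕ) :
    expect (lazyElement S ^ 2 ^ k) (fun g => ‖b g‖ ^ 2) ≤
      2 ^ k * expect (lazyElement S) (fun g => ‖b g‖ ^ 2) := by
  induction k with
  | zero => simp
  | succ k ih =>
    rw [pow_succ 2 k, mul_two, pow_add, expect_mul]
    simp only [norm_cocycle_mul hb]
    rw [expect_lazyElement_pow_inv hsym (2 ^ k)
      (fun x => expect (lazyElement S ^ 2 ^ k) fun y => ‖b y - b x‖ ^ 2)]
    have := expect_expect_norm_sub_sq_le _ (expect_lazyElement_pow_one hS (2 ^ k)) b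
    rw [pow_succ]
    linarith

end Cocycle

section Entropy

variable {G : Type*} [Group G]

/-- Gibbs' inequality against the unnormalised density `exp (-w)`. -/
theorem entropy_le_of_sum_exp_neg_le (q : MonoidAlgebra ℝ G) (hq : ∀ g, 0 ≤ q.coeff g)
    (w : G → ℝ) {Z : ℝ} (hZ : ∀ F : Finset G, ∑ g ∈ F, Real.exp (-w g) ≤ Z) :
    entropy q.coeff ≤ Z + expect q w := by
  rw [entropy, tsum_eq_sum (s := q.coeff.support), ← Finset.sum_neg_distrib]
  · refine le_trans ?_ (add_le_add_left (hZ q.coeff.support) _)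
    rw [expect_eq_sum, ← Finset.sum_add_distrib]
    refine Finset.sum_le_sum fun g hg => ?_
    have hpos : 0 < q.coeff g := lt_of_le_of_ne (hq g) (Finsupp.mem_support_iff.1 hg).symm
    have hlog := Real.log_le_sub_one_of_pos (div_pos (Real.exp_pos (-w g)) hpos)
    rw [Real.log_div (Real.exp_pos _).ne' hpos.ne', Real.log_exp] at hlog
    have := mul_le_mul_of_nonneg_left hlog hpos.le
    rw [mul_sub, mul_sub, mul_div_cancel₀ _ hpos.ne'] at this
    rw [smul_eq_mul]
    linarith
  · intro g hg
    rw [Finsupp.notMem_support_iff.1 hg, zero_mul]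

end Entropy

/-- A power bound along the powers of two forces the corresponding inequality of exponents. -/
theorem exponent_le_of_pow_two_bound {a B C h r : ℝ} (ha : 0 < a) (hB : 0 ≤ B) (hr : 0 ≤ r)
    (hle : ∀ k : ℕ, a * ((2 : ℝ) ^ k) ^ h ≤ B + C * ((2 : ℝ) ^ k) ^ r) : h ≤ r := by
  by_contra! hlt
  have ht : Filter.Tendsto (fun k : ℕ => ((2 : ℝ) ^ k) ^ (h - r)) Filter.atTop Filter.atTop :=
    (tendsto_rpow_atTop (sub_pos.2 hlt)).comp (tendsto_pow_atTop_atTop_of_one_lt one_lt_two)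
  obtain ⟨k, hk⟩ := (ht.eventually_gt_atTop ((B + C) / a)).exists
  have hpos : (0 : ℝ) < ((2 : ℝ) ^ k) ^ r := by positivity
  have hone : (1 : ℝ) ≤ ((2 : ℝ) ^ k) ^ r := Real.one_le_rpow (one_le_pow₀ one_le_two) hr
  rw [Real.rpow_sub (by positivity), div_lt_div_iff₀ ha hpos] at hk
  nlinarith [hle k]

/-- if `|B_n| ≤ L·exp(K·n^ν)` and `H(P^{(n)}) ≥ K' + L'·n^h`, then every
equivariant Hilbertian cocycle with compression function `≥ K''·|g|^c` satisfies
`2hc ≤ ν` (i.e. `2hα ≤ ν`). -/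
theorem stmt7 {G : Type*} [Group G] (S : Finset G)
    (hS1 : (1 : G) ∉ S) (hSne : S.Nonempty) (hsym : ∀ s ∈ S, s⁻¹ ∈ S)
    (hgen : Subgroup.closure (S : Set G) = ⊤)
    (K L ν : ℝ) (hK : 0 < K) (hL : 0 < L) (hν0 : 0 < ν) (hν1 : ν ≤ 1)
    (hvol : ∀ n : ℕ, 1 ≤ n →
      (Nat.card ↥(ball (S : Set G) n) : ℝ) ≤ L * Real.exp (K * (n : ℝ) ^ ν))
    (K' L' h : ℝ) (hK' : 0 < K') (hL' : 0 < L') (hh0 : 0 < h) (hh1 : h ≤ 1)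
    (hent : ∀ n : ℕ, 1 ≤ n →
      K' + L' * (n : ℝ) ^ h ≤ entropy (convPow (lazyWalk S) n))
    (Hs : Type*) [NormedAddCommGroup Hs] [InnerProductSpace ℝ Hs] [CompleteSpace Hs]
    (lam : G →* (Hs ≃ₗᵢ[ℝ] Hs)) (b : G → Hs)
    (hb : ∀ x y : G, b (x * y) = lam x (b y) + b x)
    (c K'' : ℝ) (hc : 0 ≤ c) (hK'' : 0 < K'')
    (hlow : ∀ g : G, K'' * (wordLength (S : Set G) g : ℝ) ^ c ≤ ‖b g‖) :
    2 * h * c ≤ ν := by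
  rcases lt_or_ge (2 * c) ν with hcν | hcν
  · nlinarith
  obtain ⟨Z, hZ0, hZ⟩ := exists_sum_exp_neg_wordLength_le hsym hgen hK hL hν0 hvol
  set M := expect (lazyElement S) (fun g => ‖b g‖ ^ 2) with hM
  have hc0 : 0 < 2 * c := hν0.trans_le hcν
  set p := 2 * c / ν with hp
  have hp1 : 1 ≤ p := (one_le_div hν0).2 hcν
  have hp0 : 0 < p := one_pos.trans_le hp1
  have hM0 : 0 ≤ M := by
    rw [hM, expect_eq_sum]
    refine Finset.sum_nonneg fun g _ => smul_nonneg ?_ (by positivity)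
    simpa using coeff_lazyElement_pow_nonneg S 1 g
  have hbound : h ≤ 1 / p := by
    refine exponent_le_of_pow_two_bound (C := 2 * K * (M / K'' ^ 2) ^ (1 / p)) hL' hZ0
      (by positivity) fun k => ?_
    set q := lazyElement S ^ 2 ^ k with hq
    have hq0 : ∀ g, 0 ≤ q.coeff g := coeff_lazyElement_pow_nonneg S _
    have hcoe : (q.coeff : G → ℝ) = convPow (lazyWalk S) (2 ^ k) :=
      funext (coeff_lazyElement_pow S _)
    have hmass : ∑ g ∈ q.coeff.support, q.coeff g = 1 := by
      simpa [expect_eq_sum] using expect_lazyElement_pow_one hSne (2 ^ k)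
    set A := ∑ g ∈ q.coeff.support, q.coeff g * (wordLength (S : Set G) g : ℝ) ^ ν with hA
    have hA0 : 0 ≤ A := Finset.sum_nonneg fun g _ => mul_nonneg (hq0 g) (by positivity)
    have hH : entropy (convPow (lazyWalk S) (2 ^ k)) ≤ Z + 2 * K * A := by
      rw [← hcoe]
      refine (entropy_le_of_sum_exp_neg_le q hq0 _ hZ).trans_eq ?_
      rw [expect_eq_sum, hA, Finset.mul_sum]
      congr 1
      refine Finset.sum_congr rfl fun g _ => ?_
      rw [smul_eq_mul]
      ring
    have hAp : A ^ p ≤ M / K'' ^ 2 * 2 ^ k := by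
      calc A ^ p ≤ ∑ g ∈ q.coeff.support,
            q.coeff g * ((wordLength (S : Set G) g : ℝ) ^ ν) ^ p :=
            Real.rpow_arith_mean_le_arith_mean_rpow _ _ _ (fun g _ => hq0 g) hmass
              (fun g _ => by positivity) hp1
        _ ≤ ∑ g ∈ q.coeff.support, q.coeff g * (‖b g‖ ^ 2 / K'' ^ 2) := by
            refine Finset.sum_le_sum fun g _ => mul_le_mul_of_nonneg_left ?_ (hq0 g)
            have hνp : ν * p = c * (2 : ℕ) := by
              rw [hp]
              push_cast
              field_simp
            rw [← Real.rpow_mul (Nat.cast_nonneg _), hνp, Real.rpow_mul (Nat.cast_nonneg _),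
              Real.rpow_natCast, le_div_iff₀ (by positivity), mul_comm, ← mul_pow]
            exact pow_le_pow_left₀ (by positivity) (hlow g) 2
        _ = expect q (fun g => ‖b g‖ ^ 2) / K'' ^ 2 := by
            rw [expect_eq_sum, Finset.sum_div]
            refine Finset.sum_congr rfl fun g _ => ?_
            rw [smul_eq_mul, mul_div_assoc]
        _ ≤ 2 ^ k * M / K'' ^ 2 := by
            gcongr
            exact expect_norm_cocycle_sq_le hSne hsym hb k
        _ = _ := by ring
    have hA' : A ≤ (M / K'' ^ 2) ^ (1 / p) * ((2 : ℝ) ^ k) ^ (1 / p) := by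
      rw [← Real.mul_rpow (by positivity) (by positivity)]
      calc A = (A ^ p) ^ (1 / p) := by
            rw [← Real.rpow_mul hA0, mul_one_div_cancel hp0.ne', Real.rpow_one]
        _ ≤ _ := Real.rpow_le_rpow (by positivity) hAp (by positivity)
    have hE := hent (2 ^ k) Nat.one_le_two_pow
    push_cast at hE
    nlinarith [mul_le_mul_of_nonneg_left hA' (by positivity : 0 ≤ 2 * K)]
  have := mul_le_mul_of_nonneg_right hbound hc0.le
  have hval : 1 / p * (2 * c) = ν := by
    rw [hp, one_div_div, div_mul_cancel₀ _ hc0.ne']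
  linarith
end

section
/- Let G be a group with a finite symmetric generating set S (e ∉ S) and let P be the lazy simple random walk measure. Then for every n ≥ 0, Σ_{x∈G} Σ_{s∈S} (P^{(n)}(xs) − P^{(n)}(x))² = 4·|S|·(P^{(2n)}(e) − P^{(2n+1)}(e)). In other words, the squared ℓ²-norm of the gradient of P^{(n)} (viewed as a function on G × S via ∇f(x,s) = f(xs) − f(x)) equals 4|S|(P^{(2n)}(e) − P^{(2n+1)}(e)). -/
open scoped Classical

/-- Averaging recursion for the convolution powers of the lazy walk. -/
theorem convPow_lazyWalk_succ {G : Type*} [Group G] {S : Finset G}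
    (hsym : ∀ s ∈ S, s⁻¹ ∈ S) (n : ℕ) (g : G) :
    convPow (lazyWalk S) (n + 1) g =
      convPow (lazyWalk S) n g / 2 +
        (∑ s ∈ S, convPow (lazyWalk S) n (g * s)) / (2 * (S.card : ℝ)) := by
  have hinv : ∀ k : G, k⁻¹ ∈ S ↔ k ∈ S := fun k =>
    ⟨fun h => by simpa using hsym _ h, hsym k⟩
  change ∑' h : G, convPow (lazyWalk S) n h * lazyWalk S (h⁻¹ * g) = _
  rw [← (Equiv.mulLeft g).tsum_eq]
  have h1 := hasSum_ite_eq (1 : G) (convPow (lazyWalk S) n g / 2)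
  have h2 := hasSum_sum (s := S) fun s _ =>
    hasSum_ite_eq s (convPow (lazyWalk S) n (g * s) / (2 * (S.card : ℝ)))
  rw [Finset.sum_div, ← (h1.add h2).tsum_eq]
  refine tsum_congr fun k => ?_
  rw [Finset.sum_ite_eq]
  simp only [Equiv.coe_mulLeft, lazyWalk, mul_inv_rev, inv_mul_cancel_right, inv_eq_one, hinv]
  by_cases hk : k = 1 <;> by_cases hS : k ∈ S <;> simp_all <;> ring

/-- The convolution powers of the lazy walk are finitely supported. -/
theorem finite_support_convPow_lazyWalk {G : Type*} [Group G] {S : Finset G}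
    (hsym : ∀ s ∈ S, s⁻¹ ∈ S) (n : ℕ) :
    (Function.support (convPow (lazyWalk S) n)).Finite := by
  induction n with
  | zero =>
    refine (Set.finite_singleton (1 : G)).subset fun g hg => ?_
    by_contra h
    exact hg (if_neg h)
  | succ n ih =>
    refine (ih.union (S.finite_toSet.biUnion fun s _ =>
      ih.preimage (mul_left_injective s).injOn)).subset fun g hg => ?_
    by_contra h
    simp only [Set.mem_union, Set.mem_iUnion, Set.mem_preimage, Function.mem_support,
      SetLike.mem_coe, not_or, not_exists, not_not] at h
    apply hg
    rw [convPow_lazyWalk_succ hsym, h.1, Finset.sum_eq_zero fun s hs => h.2 s hs]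
    simp

/-- Shifted products with a finitely supported function are summable. -/
theorem summable_mul_shift {G : Type*} [Group G] {f : G → ℝ} (hf : (Function.support f).Finite)
    (u : G → ℝ) (s : G) : Summable fun x => f x * u (x * s) :=
  summable_of_hasFiniteSupport (hf.subset (Function.support_mul_subset_left _ _))

/-- Averaging over a symmetric set is self-adjoint. -/
theorem tsum_sum_shift_mul {G : Type*} [Group G] {S : Finset G}
    (hsym : ∀ s ∈ S, s⁻¹ ∈ S) {f u : G → ℝ} (hf : (Function.support f).Finite)
    (hu : (Function.support u).Finite) :
    ∑' x, (∑ s ∈ S, f (x * s)) * u x = ∑' x, f x * ∑ s ∈ S, u (x * s) := by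
  simp_rw [Finset.mul_sum, Finset.sum_mul]
  rw [Summable.tsum_finsetSum fun s _ => summable_mul_shift hf u s,
    Summable.tsum_finsetSum fun s _ => by
      simpa only [mul_comm] using summable_mul_shift hu f s]
  refine Finset.sum_bij' (fun s _ => s⁻¹) (fun s _ => s⁻¹) hsym hsym (by simp) (by simp)
    fun s _ => ?_
  rw [← (Equiv.mulRight s).tsum_eq fun x => f x * u (x * s⁻¹)]
  simp

/-- Pairing with the averaged walk. -/
theorem tsum_mul_convPow_lazyWalk_succ {G : Type*} [Group G] {S : Finset G}
    (hsym : ∀ s ∈ S, s⁻¹ ∈ S) {f : G → ℝ} (hf : (Function.support f).Finite) (m : ℕ) :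
    ∑' x, f x * convPow (lazyWalk S) (m + 1) x =
      (∑' x, f x * convPow (lazyWalk S) m x) / 2 +
        (∑' x, f x * ∑ s ∈ S, convPow (lazyWalk S) m (x * s)) / (2 * (S.card : ℝ)) := by
  have hsum (u : G → ℝ) : Summable fun x => f x * u x := by
    simpa using summable_mul_shift hf u 1
  rw [← tsum_div_const, ← tsum_div_const,
    ← Summable.tsum_add ((hsum _).div_const _) ((hsum _).div_const _)]
  refine tsum_congr fun x => ?_
  rw [convPow_lazyWalk_succ hsym]
  ring

/-- `⟨P^{(n)}, P^{(m)}⟩ = P^{(n+m)}(e)`. -/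
theorem tsum_convPow_mul_convPow {G : Type*} [Group G] {S : Finset G}
    (hsym : ∀ s ∈ S, s⁻¹ ∈ S) (n m : ℕ) :
    ∑' x, convPow (lazyWalk S) n x * convPow (lazyWalk S) m x =
      convPow (lazyWalk S) (n + m) 1 := by
  induction n generalizing m with
  | zero =>
    rw [Nat.zero_add, tsum_eq_single 1 fun x hx => by simp [convPow, hx]]
    simp [convPow]
  | succ n ih =>
    have hn := finite_support_convPow_lazyWalk hsym n
    have hm := finite_support_convPow_lazyWalk hsym m
    rw [show n + 1 + m = n + (m + 1) by ring, ← ih, tsum_mul_convPow_lazyWalk_succ hsym hn,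
      ← tsum_sum_shift_mul hsym hn hm]
    simp_rw [mul_comm _ (convPow (lazyWalk S) m _)]
    exact tsum_mul_convPow_lazyWalk_succ hsym hm n

/-- The Dirichlet form of a finitely supported function, expanded. -/
theorem tsum_sum_sq_sub {G : Type*} [Group G] (S : Finset G) {f : G → ℝ}
    (hf : (Function.support f).Finite) :
    ∑' x, ∑ s ∈ S, (f (x * s) - f x) ^ 2 =
      2 * (S.card : ℝ) * ∑' x, f x * f x - 2 * ∑' x, f x * ∑ s ∈ S, f (x * s) := by
  have hsq : Summable fun x => f x * f x := by simpa using summable_mul_shift hf f 1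
  have hshift (s : G) : HasSum (fun x => f (x * s) * f (x * s)) (∑' x, f x * f x) :=
    (Equiv.mulRight s).hasSum_iff.mpr hsq.hasSum
  have hcross (s : G) := (summable_mul_shift hf f s).hasSum
  have hgrad := hasSum_sum (s := S) fun s _ =>
    ((hshift s).add hsq.hasSum).sub ((hcross s).mul_left 2)
  simp_rw [Finset.mul_sum, Summable.tsum_finsetSum fun s _ => summable_mul_shift hf f s]
  trans
  · refine (tsum_congr fun x => Finset.sum_congr rfl fun s _ => ?_).trans hgrad.tsum_eq
    ring
  · rw [Finset.sum_sub_distrib, Finset.sum_const, nsmul_eq_mul, ← Finset.mul_sum]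
    ring

/-- `‖∇P^{(n)}‖² = 4|S|(P^{(2n)}(e) − P^{(2n+1)}(e))`. -/
theorem stmt9 {G : Type*} [Group G] (S : Finset G)
    (hS1 : (1 : G) ∉ S) (hSne : S.Nonempty) (hsym : ∀ s ∈ S, s⁻¹ ∈ S)
    (hgen : Subgroup.closure (S : Set G) = ⊤) :
    ∀ n : ℕ,
      (∑' x : G, ∑ s ∈ S, (convPow (lazyWalk S) n (x * s) - convPow (lazyWalk S) n x) ^ 2) =
        4 * (S.card : ℝ) *
          (convPow (lazyWalk S) (2 * n) 1 - convPow (lazyWalk S) (2 * n + 1) 1) := by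
  intro n
  have hn := finite_support_convPow_lazyWalk hsym n
  have hcard : (S.card : ℝ) ≠ 0 := by exact_mod_cast hSne.card_ne_zero
  rw [tsum_sum_sq_sub S hn, two_mul n, add_assoc n n 1, ← tsum_convPow_mul_convPow hsym n n,
    ← tsum_convPow_mul_convPow hsym n (n + 1), tsum_mul_convPow_lazyWalk_succ hsym hn]
  field_simp
  ring
end

section
/- Let f : ℕ → ℝ be nonnegative, nondecreasing, subadditive (f(n+m) ≤ f(n) + f(m)) with f(0) = 0, and let g : [0,∞) → ℝ be the concave hull of f, i.e. the pointwise infimum of all concave functions h : [0,∞) → ℝ satisfying h(k) ≥ f(k) for every k ∈ ℕ. Then g is well defined (the infimum is finite) and for every n ∈ ℕ one has f(n) ≤ g(n) ≤ 2·f(n). -/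
open scoped Classical

/-- Evaluation of a concave majorant of a nonnegative function is nonnegative. -/
theorem nonneg_of_mem_concaveMajorants {f : ℕ → ℝ} (hf0 : ∀ n, 0 ≤ f n) {x y : ℝ} (hx : 0 ≤ x)
    (hy : y ∈ concaveMajorants f x) : 0 ≤ y := by
  obtain ⟨h, hc, hm, rfl⟩ := hy
  obtain ⟨k, hk⟩ := exists_nat_ge x
  have hle := hc.min_le_of_mem_Icc (Set.mem_Ici.2 (Nat.cast_nonneg 0))
    (Set.mem_Ici.2 (Nat.cast_nonneg k)) (show x ∈ Set.Icc ((0 : ℕ) : ℝ) k from ⟨by simpa, hk⟩)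
  exact (le_min ((hf0 0).trans (hm 0)) ((hf0 k).trans (hm k))).trans hle

/-- An affine majorant of `f` on `ℕ` contributes its values to the concave majorants. -/
theorem affine_mem_concaveMajorants {f : ℕ → ℝ} {a b : ℝ} (hab : ∀ k : ℕ, f k ≤ a * k + b)
    (x : ℝ) : a * x + b ∈ concaveMajorants f x := by
  refine ⟨fun x ↦ a * x + b, ⟨convex_Ici 0, fun x _ y _ s t _ _ hst ↦ le_of_eq ?_⟩, hab, rfl⟩
  simp only [smul_eq_mul]
  linear_combination b * hst

theorem le_nat_mul_of_subadditive {f : ℕ → ℝ} (hsub : ∀ n m, f (n + m) ≤ f n + f m)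
    (hzero : f 0 = 0) (n q : ℕ) : f (n * q) ≤ q * f n := by
  induction q with
  | zero => simp [hzero]
  | succ q ih =>
    have := hsub (n * q) n
    push_cast
    rw [Nat.mul_succ]
    linarith

/-- A monotone subadditive function lies below the affine function through `(0, f n)`
of slope `f n / n`. -/
theorem le_affine_of_subadditive {f : ℕ → ℝ} (hf0 : ∀ n, 0 ≤ f n) (hmono : Monotone f)
    (hsub : ∀ n m, f (n + m) ≤ f n + f m) (hzero : f 0 = 0) {n : ℕ} (hn : 0 < n) (k : ℕ) :
    f k ≤ f n / n * k + f n := by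
  have hq := le_nat_mul_of_subadditive hsub hzero n (k / n)
  have hr : f (k % n) ≤ f n := hmono (Nat.mod_lt k hn).le
  have hs := hsub (n * (k / n)) (k % n)
  rw [Nat.div_add_mod] at hs
  have hdiv : ((k / n : ℕ) : ℝ) * f n ≤ (k : ℝ) / n * f n :=
    mul_le_mul_of_nonneg_right Nat.cast_div_le (hf0 n)
  have heq : (k : ℝ) / n * f n = f n / n * k := by ring
  linarith

/-- the concave hull `g` of a nonnegative nondecreasing subadditive
`f : ℕ → ℝ` with `f 0 = 0` is well defined, and `f(n) ≤ g(n) ≤ 2 f(n)` for all `n`. -/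
theorem stmt13 (f : ℕ → ℝ) (hf0 : ∀ n, 0 ≤ f n) (hmono : Monotone f)
    (hsub : ∀ n m, f (n + m) ≤ f n + f m) (hzero : f 0 = 0) :
    (∀ x : ℝ, 0 ≤ x → (concaveMajorants f x).Nonempty ∧ BddBelow (concaveMajorants f x)) ∧
      ∀ n : ℕ, f n ≤ concaveHull f n ∧ concaveHull f n ≤ 2 * f n := by
  have hlin (k : ℕ) : f k ≤ f 1 * k + 0 := by
    simpa [mul_comm] using le_nat_mul_of_subadditive hsub hzero 1 k
  have hne (x : ℝ) : (concaveMajorants f x).Nonempty := ⟨_, affine_mem_concaveMajorants hlin x⟩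
  have hbdd (x : ℝ) (hx : 0 ≤ x) : BddBelow (concaveMajorants f x) :=
    ⟨0, fun _ hy ↦ nonneg_of_mem_concaveMajorants hf0 hx hy⟩
  refine ⟨fun x hx ↦ ⟨hne x, hbdd x hx⟩, fun n ↦ ⟨?_, ?_⟩⟩
  · refine le_csInf (hne n) ?_
    rintro _ ⟨h, -, hm, rfl⟩
    exact hm n
  · obtain rfl | hn := n.eq_zero_or_pos
    · refine (csInf_le (hbdd _ (by simp)) (affine_mem_concaveMajorants hlin _)).trans ?_
      simp [hzero]
    · refine (csInf_le (hbdd _ n.cast_nonneg) (affine_mem_concaveMajorants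
        (le_affine_of_subadditive hf0 hmono hsub hzero hn) _)).trans (le_of_eq ?_)
      have : (n : ℝ) ≠ 0 := by positivity
      field_simp
      ring
end
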